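/- Let V be a nonnegative random variable with Laplace transform E[exp(-λV)] = 3^{3/2}·cosh((2λ)^{1/4})·(cosh^2((2λ)^{1/4})+2)^{-3/2} for λ ≥ 0. Then for β ∈ ℝ, E[V^β] < ∞ if and only if β < 3/2. -/

import Mathlib

open MeasureTheory Real

open Filter Topology

/-- Sufficiently fast polynomial decay of the tail gives finite moments. -/
lemma lintegral_rpow_lt_top_of_tail {Ω : Type*} [MeasurableSpace Ω] (μ : Measure Ω)
    [IsProbabilityMeasure μ] {X : Ω → ℝ} (hX : ∀ ω, 0 ≤ X ω) (hm : AEMeasurable X μ)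
    {C k p : ℝ} (hp : 0 < p) (hpk : p < k)
    (htail : ∀ᶠ t in atTop, μ {ω | t ≤ X ω} ≤ ENNReal.ofReal (C * t ^ (-k))) :
    ∫⁻ ω, ENNReal.ofReal (X ω ^ p) ∂μ < ⊤ := by
  obtain ⟨T, hT1, hT⟩ := (eventually_atTop.1 htail).elim fun a ha =>
    (⟨max a 1, le_max_right _ _, fun t ht => ha t ((le_max_left _ _).trans ht)⟩ :
      ∃ T : ℝ, 1 ≤ T ∧ ∀ t ≥ T, μ {ω | t ≤ X ω} ≤ ENNReal.ofReal (C * t ^ (-k)))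
  have hT0 : 0 < T := by linarith
  rw [lintegral_rpow_eq_lintegral_meas_le_mul μ (Eventually.of_forall hX) hm hp]
  refine ENNReal.mul_lt_top ENNReal.ofReal_lt_top ?_
  rw [← Set.Ioc_union_Ioi_eq_Ioi hT0.le]
  refine (lintegral_union_le _ _ _).trans_lt (ENNReal.add_lt_top.2 ⟨?_, ?_⟩)
  · have hi : IntegrableOn (fun t : ℝ => t ^ (p - 1)) (Set.Ioc 0 T) :=
      (intervalIntegrable_iff_integrableOn_Ioc_of_le hT0.le).1
        (intervalIntegral.intervalIntegrable_rpow' (by linarith))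
    refine (lintegral_mono fun t => ?_).trans_lt hi.lintegral_lt_top
    exact mul_le_of_le_one_left zero_le prob_le_one
  · have hi : IntegrableOn (fun t : ℝ => C * t ^ (p - 1 - k)) (Set.Ioi T) :=
      (integrableOn_Ioi_rpow_of_lt (by linarith) hT0).const_mul C
    refine (setLIntegral_mono' measurableSet_Ioi fun t ht => ?_).trans_lt hi.lintegral_lt_top
    have ht : T < t := ht
    have ht0 : 0 < t := hT0.trans ht
    refine (mul_le_mul_left (hT t ht.le) _).trans ?_
    rw [← ENNReal.ofReal_mul' (by positivity), mul_assoc, ← Real.rpow_add ht0]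
    exact le_of_eq (by ring_nf)

lemma sinh_taylor_bound {x : ℝ} (hx0 : 0 < x) (hx1 : x ≤ 1) :
    |sinh x - x - x ^ 3 / 6| ≤ x ^ 5 := by
  have h1 := Real.exp_bound (x := x) (by rwa [abs_of_pos hx0]) (n := 5) (by norm_num)
  have h2 := Real.exp_bound (x := -x) (by rwa [abs_neg, abs_of_pos hx0]) (n := 5) (by norm_num)
  simp only [abs_neg, abs_of_pos hx0, Finset.sum_range_succ, Finset.sum_range_zero,
    Nat.factorial] at h1 h2
  norm_num at h1 h2
  have := pow_pos hx0 5
  rw [Real.sinh_eq]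
  rw [abs_le] at *
  constructor <;> ring_nf at * <;> linarith [h1.1, h1.2, h2.1, h2.2]

/-- The Laplace transform of the hull volume, in the variable `x = (2 * l) ^ (1 / 4)`. -/
noncomputable def hullProfile (x : ℝ) : ℝ :=
  3 ^ ((3 : ℝ) / 2) * cosh x * (cosh x ^ 2 + 2) ^ (-(3 : ℝ) / 2)

lemma hullProfile_pos (x : ℝ) : 0 < hullProfile x := by
  have := cosh_pos x
  unfold hullProfile
  positivity

lemma hullProfile_sq (x : ℝ) :
    hullProfile x ^ 2 * (1 + sinh x ^ 2 / 3) ^ 3 = 1 + sinh x ^ 2 := by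
  have hc : cosh x ^ 2 = 1 + sinh x ^ 2 := by rw [cosh_sq]; ring
  have hpos : 0 < cosh x ^ 2 + 2 := by positivity
  have h3 : ((3 : ℝ) ^ ((3 : ℝ) / 2)) ^ 2 = 27 := by
    rw [← rpow_natCast, ← rpow_mul (by norm_num)]
    norm_num
  have h4 : ((cosh x ^ 2 + 2) ^ (-(3 : ℝ) / 2)) ^ 2 = ((cosh x ^ 2 + 2) ^ 3)⁻¹ := by
    rw [← rpow_natCast, ← rpow_mul hpos.le, ← rpow_natCast _ 3, ← rpow_neg hpos.le]
    norm_num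
  unfold hullProfile
  rw [mul_pow, mul_pow, h3, h4]
  have h5 : 1 + sinh x ^ 2 / 3 = (cosh x ^ 2 + 2) / 3 := by rw [hc]; ring
  rw [h5, ← hc]
  field_simp
  norm_num

lemma continuous_hullProfile : Continuous hullProfile := by
  unfold hullProfile
  refine (continuous_const.mul continuous_cosh).mul ?_
  refine ((continuous_cosh.pow 2).add continuous_const).rpow_const fun x => Or.inl ?_
  exact (by positivity : (0 : ℝ) < cosh x ^ 2 + 2).ne'

lemma hullProfile_zero : hullProfile 0 = 1 := by
  have h := hullProfile_sq 0
  have := hullProfile_pos 0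
  simp only [sinh_zero] at h
  nlinarith

lemma tendsto_sinh_sub_div_cube :
    Tendsto (fun x => (sinh x - x) / x ^ 3) (𝓝[>] 0) (𝓝 (1 / 6)) := by
  rw [tendsto_iff_dist_tendsto_zero]
  have h2 : Tendsto (fun x : ℝ => x ^ 2) (𝓝[>] 0) (𝓝 0) := by
    have h : Tendsto (fun x : ℝ => x ^ 2) (𝓝 0) (𝓝 0) := by
      simpa using (continuous_pow 2).tendsto (0 : ℝ)
    exact h.mono_left nhdsWithin_le_nhds
  refine squeeze_zero' (Eventually.of_forall fun _ => dist_nonneg) ?_ h2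
  filter_upwards [Ioo_mem_nhdsGT (zero_lt_one (α := ℝ))] with x hx
  have hx0 : 0 < x := hx.1
  have h := sinh_taylor_bound hx0 hx.2.le
  have e : (sinh x - x) / x ^ 3 - 1 / 6 = (sinh x - x - x ^ 3 / 6) / x ^ 3 := by
    field_simp
  rw [Real.dist_eq, e, abs_div, abs_of_pos (pow_pos hx0 3), div_le_iff₀ (pow_pos hx0 3)]
  exact h.trans_eq (by ring)

/-- Third-order expansion: `hullProfile x = 1 - x ^ 4 / 6 + x ^ 6 / 27 + o(x ^ 6)`. -/
lemma tendsto_hullProfile_remainder :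
    Tendsto (fun x => (hullProfile x - 1 + x ^ 4 / 6) / x ^ 6) (𝓝[>] 0) (𝓝 (1 / 27)) := by
  have hx : Tendsto (fun x : ℝ => x) (𝓝[>] 0) (𝓝 0) := nhdsWithin_le_nhds
  have hq := tendsto_sinh_sub_div_cube
  have hF : Tendsto hullProfile (𝓝[>] 0) (𝓝 1) := by
    have := continuous_hullProfile.tendsto 0
    rw [hullProfile_zero] at this
    exact this.mono_left nhdsWithin_le_nhds
  have hs : Tendsto (fun x => sinh x ^ 2) (𝓝[>] 0) (𝓝 0) := by
    have := (continuous_sinh.pow 2).tendsto 0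
    have e : (sinh ^ 2) 0 = 0 := by simp
    rw [e] at this
    exact this.mono_left nhdsWithin_le_nhds
  set q : ℝ → ℝ := fun x => (sinh x - x) / x ^ 3 with hqdef
  set s : ℝ → ℝ := fun x => sinh x ^ 2 with hsdef
  set D : ℝ → ℝ := fun x => (1 + s x / 3) ^ 3 * (1 + hullProfile x) with hD
  have hDt : Tendsto D (𝓝[>] 0) (𝓝 2) := by
    have := (((hs.div_const 3).const_add 1).pow 3).mul (hF.const_add 1)
    convert this using 2; norm_num
  have hu : Tendsto (fun x => (1 + x ^ 2 * q x) ^ 2) (𝓝[>] 0) (𝓝 1) := by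
    have := (((hx.pow 2).mul hq).const_add 1).pow 2
    convert this using 2; norm_num
  have hw : Tendsto (fun x => q x * (2 + x ^ 2 * q x)) (𝓝[>] 0) (𝓝 (1 / 3)) := by
    have := hq.mul (((hx.pow 2).mul hq).const_add 2)
    convert this using 2; norm_num
  have hB : Tendsto (fun x => (s x * (1 / 3 + s x / 27) / D x + 2 / 9
      - (1 + hullProfile x) * (1 + s x / 3 + s x ^ 2 / 27)) / (6 * D x)) (𝓝[>] 0)
      (𝓝 (-4 / 27)) := by
    have h1 := (hs.mul ((hs.div_const 27).const_add (1 / 3))).div hDt (by norm_num)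
    have h2 := (hF.const_add 1).mul (((hs.div_const 3).const_add 1).add ((hs.pow 2).div_const 27))
    have := ((h1.add_const (2 / 9)).sub h2).div (hDt.const_mul 6) (by norm_num)
    have e : (0 * (1 / 3 + 0 / 27) / 2 + 2 / 9 - (1 + 1) * (1 + 0 / 3 + 0 ^ 2 / 27)) / (6 * 2)
      = (-4 / 27 : ℝ) := by norm_num
    rw [e] at this
    exact this
  have key := ((hw.mul (hu.const_add 1)).neg.div_const 6).sub ((hu.pow 3).mul hB)
  have e : -(1 / 3 * (1 + 1)) / 6 - 1 ^ 3 * (-4 / 27) = (1 / 27 : ℝ) := by norm_num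
  rw [e] at key
  refine key.congr' ?_
  filter_upwards [self_mem_nhdsWithin] with x hx0
  have hx0 : 0 < x := hx0
  have hsq := hullProfile_sq x
  have hFp := hullProfile_pos x
  have hs0 : 0 ≤ s x := sq_nonneg _
  have hDp : 0 < D x := by simp only [hD]; positivity
  have hS : sinh x = x * (1 + x ^ 2 * q x) := by
    simp only [hqdef]; field_simp; ring
  have hu' : s x = x ^ 2 * (1 + x ^ 2 * q x) ^ 2 := by
    simp only [hsdef]; rw [hS]; ring
  have hone : (1 - hullProfile x) * D x = s x ^ 2 * (1 / 3 + s x / 27) := by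
    change hullProfile x ^ 2 * (1 + s x / 3) ^ 3 = 1 + s x at hsq
    simp only [hD]
    linear_combination -hsq
  have hDdef : D x = (1 + s x / 3) ^ 3 * (1 + hullProfile x) := rfl
  have hFs : hullProfile x = 1 - s x ^ 2 / 6 - s x ^ 3 * ((s x * (1 / 3 + s x / 27) / D x + 2 / 9
      - (1 + hullProfile x) * (1 + s x / 3 + s x ^ 2 / 27)) / (6 * D x)) := by
    have e1 : s x ^ 3 * ((s x * (1 / 3 + s x / 27) / D x + 2 / 9
      - (1 + hullProfile x) * (1 + s x / 3 + s x ^ 2 / 27)) / (6 * D x)) =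
      s x ^ 2 * (s x ^ 2 * (1 / 3 + s x / 27) / D x + s x * (2 / 9
      - (1 + hullProfile x) * (1 + s x / 3 + s x ^ 2 / 27))) / (6 * D x) := by
      field_simp
      ring
    have e2 : s x ^ 2 * (1 / 3 + s x / 27) / D x = 1 - hullProfile x := by
      rw [← hone]; field_simp
    rw [e1, e2]
    have e3 : 1 - hullProfile x + s x * (2 / 9
      - (1 + hullProfile x) * (1 + s x / 3 + s x ^ 2 / 27)) = 2 + 2 / 9 * s x - D x := by
      rw [hDdef]; ring
    rw [e3]
    field_simp
    linear_combination -54 * hone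
  set B := (s x * (1 / 3 + s x / 27) / D x + 2 / 9
      - (1 + hullProfile x) * (1 + s x / 3 + s x ^ 2 / 27)) / (6 * D x) with hBdef
  rw [hFs, hu']
  field_simp
  ring

lemma hullProfile_le (x : ℝ) : hullProfile x ≤ 3 ^ ((3 : ℝ) / 2) * (cosh x ^ 2)⁻¹ := by
  have hc := cosh_pos x
  have h1 : (cosh x ^ 2 + 2) ^ (-(3 : ℝ) / 2) ≤ (cosh x ^ 2) ^ (-(3 : ℝ) / 2) :=
    rpow_le_rpow_of_nonpos (by positivity) (by linarith) (by norm_num)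
  have h2 : (cosh x ^ 2) ^ (-(3 : ℝ) / 2) = (cosh x ^ 3)⁻¹ := by
    rw [← rpow_natCast, ← rpow_mul hc.le, ← rpow_natCast _ 3, ← rpow_neg hc.le]
    norm_num
  unfold hullProfile
  rw [mul_assoc]
  refine mul_le_mul_of_nonneg_left ?_ (by positivity)
  refine (mul_le_mul_of_nonneg_left (h1.trans_eq h2) hc.le).trans_eq ?_
  field_simp

/-- The Laplace transform decays faster than any power. -/
lemma hullProfile_rpow_le (n : ℕ) :
    ∃ C : ℝ, ∀ l : ℝ, 0 < l → hullProfile ((2 * l) ^ ((1 : ℝ) / 4)) ≤ C * l ^ (-(n : ℝ)) := by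
  refine ⟨3 ^ ((3 : ℝ) / 2) * (2 * (2 * n).factorial) ^ 2 / 2 ^ n, fun l hl => ?_⟩
  set x := (2 * l) ^ ((1 : ℝ) / 4) with hx
  have hx0 : 0 < x := by positivity
  have hx4 : x ^ 4 = 2 * l := by
    rw [hx, ← rpow_natCast, ← rpow_mul (by positivity)]
    norm_num
  have hf : (0 : ℝ) < (2 * n).factorial := by positivity
  have h1 : x ^ (2 * n) / (2 * (2 * n).factorial) ≤ cosh x := by
    have h := pow_div_factorial_le_exp x hx0.le (2 * n)
    rw [cosh_eq]
    have := exp_pos (-x)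
    have e : x ^ (2 * n) / (2 * (2 * n).factorial) = x ^ (2 * n) / (2 * n).factorial / 2 := by
      field_simp
    rw [e]
    linarith
  refine (hullProfile_le x).trans ?_
  rw [mul_div_assoc, mul_assoc]
  refine mul_le_mul_of_nonneg_left ?_ (by positivity)
  have h2 : (x ^ (2 * n) / (2 * (2 * n).factorial)) ^ 2 ≤ cosh x ^ 2 :=
    pow_le_pow_left₀ (by positivity) h1 2
  refine (inv_anti₀ (by positivity) h2).trans_eq ?_
  have h3 : (x ^ (2 * n)) ^ 2 = 2 ^ n * l ^ n := by
    rw [← mul_pow, ← hx4]; ring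
  rw [div_pow, h3, rpow_neg hl.le, rpow_natCast]
  field_simp

/-- The singular term of order `3 / 2` at the origin, isolated by a second difference. -/
lemma exists_tendsto_hullProfile_second_difference : ∃ K : ℝ, 0 < K ∧
    Tendsto (fun l : ℝ => (1 - 2 * hullProfile ((2 * l) ^ ((1 : ℝ) / 4))
      + hullProfile ((2 * (2 * l)) ^ ((1 : ℝ) / 4))) / l ^ ((3 : ℝ) / 2)) (𝓝[>] 0) (𝓝 K) := by
  set a : ℝ := 2 ^ ((1 : ℝ) / 4) with ha
  have ha0 : 0 < a := by positivity
  have ha1 : 1 < a := one_lt_rpow (by norm_num) (by norm_num)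
  have ha4 : a ^ 4 = 2 := by
    rw [ha, ← rpow_natCast, ← rpow_mul (by positivity)]
    norm_num
  have hxt : Tendsto (fun l : ℝ => (2 * l) ^ ((1 : ℝ) / 4)) (𝓝[>] 0) (𝓝[>] 0) := by
    refine tendsto_nhdsWithin_iff.2 ⟨?_, ?_⟩
    · have hc : Continuous fun l : ℝ => (2 * l) ^ ((1 : ℝ) / 4) :=
        (continuous_const.mul continuous_id).rpow_const fun _ => Or.inr (by norm_num)
      have h := hc.tendsto 0
      rw [mul_zero, zero_rpow (by norm_num)] at h
      exact h.mono_left nhdsWithin_le_nhds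
    · filter_upwards [self_mem_nhdsWithin] with l hl
      have hl : 0 < l := hl
      exact Set.mem_Ioi.2 (by positivity)
  have hat : Tendsto (fun x : ℝ => a * x) (𝓝[>] 0) (𝓝[>] 0) := by
    refine tendsto_nhdsWithin_iff.2 ⟨?_, ?_⟩
    · have h : Tendsto (fun x : ℝ => a * x) (𝓝 0) (𝓝 0) := by
        simpa using (continuous_const_mul a).tendsto 0
      exact h.mono_left nhdsWithin_le_nhds
    · filter_upwards [self_mem_nhdsWithin] with l hl
      exact mul_pos ha0 hl
  have hR := tendsto_hullProfile_remainder
  have hlim := (((hR.comp (hat.comp hxt)).const_mul (a ^ 6)).sub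
    ((hR.comp hxt).const_mul 2)).const_mul ((2 : ℝ) ^ ((3 : ℝ) / 2))
  refine ⟨_, ?_, hlim.congr' ?_⟩
  · have : 2 < a ^ 6 := by
      rw [← ha4]
      exact pow_lt_pow_right₀ ha1 (by norm_num)
    have h2 : (0 : ℝ) < 2 ^ ((3 : ℝ) / 2) := by positivity
    refine mul_pos h2 ?_
    linarith
  · filter_upwards [self_mem_nhdsWithin] with l hl
    have hl : 0 < l := hl
    have hax : (2 * (2 * l)) ^ ((1 : ℝ) / 4) = a * (2 * l) ^ ((1 : ℝ) / 4) :=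
      mul_rpow (by norm_num) (by positivity)
    rw [hax]
    simp only [Function.comp]
    set x := (2 * l) ^ ((1 : ℝ) / 4) with hx
    have hx0 : 0 < x := by positivity
    have hx6 : x ^ 6 = 2 ^ ((3 : ℝ) / 2) * l ^ ((3 : ℝ) / 2) := by
      rw [← mul_rpow (by norm_num) hl.le, hx, ← rpow_natCast, ← rpow_mul (by positivity)]
      norm_num
    have hlp : 0 < l ^ ((3 : ℝ) / 2) := by positivity
    have h2p : (0 : ℝ) < 2 ^ ((3 : ℝ) / 2) := by positivity
    have e : l ^ ((3 : ℝ) / 2) = x ^ 6 / 2 ^ ((3 : ℝ) / 2) := by rw [hx6]; field_simp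
    rw [e]
    field_simp
    linear_combination x ^ 4 * ha4

lemma aemeasurable_of_integral_exp_ne_zero {Ω : Type*} [MeasurableSpace Ω] {μ : Measure Ω}
    {V : Ω → ℝ} (h : ∫ ω, rexp (-1 * V ω) ∂μ ≠ 0) :
    AEMeasurable V μ := by
  have hi : Integrable (fun ω => rexp (-1 * V ω)) μ := by
    by_contra hn
    exact h (integral_undef hn)
  have := (measurable_log.comp_aemeasurable hi.aestronglyMeasurable.aemeasurable).neg
  refine this.congr (Eventually.of_forall fun ω => ?_)
  simp

section LaplaceTransform

variable {Ω : Type*} [MeasurableSpace Ω] {μ : Measure Ω} [IsProbabilityMeasure μ] {V : Ω → ℝ}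

lemma integrable_exp_neg_mul (hV : ∀ ω, 0 ≤ V ω) (hm : AEMeasurable V μ) {l : ℝ} (hl : 0 ≤ l) :
    Integrable (fun ω => rexp (-l * V ω)) μ := by
  refine Integrable.of_bound (measurable_exp.comp_aemeasurable
    (hm.const_mul (-l))).aestronglyMeasurable 1 (Eventually.of_forall fun ω => ?_)
  rw [norm_eq_abs, abs_exp, exp_le_one_iff]
  have := mul_nonneg hl (hV ω)
  linarith

lemma integral_one_sub_exp_sq (hV : ∀ ω, 0 ≤ V ω) (hm : AEMeasurable V μ) {l : ℝ} (hl : 0 ≤ l) :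
    Integrable (fun ω => (1 - rexp (-l * V ω)) ^ 2) μ ∧
    ∫ ω, (1 - rexp (-l * V ω)) ^ 2 ∂μ =
      1 - 2 * ∫ ω, rexp (-l * V ω) ∂μ + ∫ ω, rexp (-(2 * l) * V ω) ∂μ := by
  have h1 := integrable_exp_neg_mul hV hm hl
  have h2 := integrable_exp_neg_mul hV hm (mul_nonneg zero_le_two hl)
  have e : (fun ω => (1 - rexp (-l * V ω)) ^ 2) =
      fun ω => (1 - 2 * rexp (-l * V ω)) + rexp (-(2 * l) * V ω) := by
    funext ω
    have : rexp (-(2 * l) * V ω) = rexp (-l * V ω) ^ 2 := by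
      rw [← exp_nat_mul]; congr 1; push_cast; ring
    rw [this]; ring
  have h3 : Integrable (fun ω => 1 - 2 * rexp (-l * V ω)) μ :=
    (integrable_const 1).sub (h1.const_mul 2)
  rw [e]
  refine ⟨h3.add h2, ?_⟩
  rw [integral_add h3 h2, integral_sub (integrable_const 1) (h1.const_mul 2),
    integral_const_mul]
  simp

lemma one_sub_exp_neg_sq_le_rpow {t p : ℝ} (ht : 0 ≤ t) (hp0 : 0 ≤ p) (hp2 : p ≤ 2) :
    (1 - rexp (-t)) ^ 2 ≤ t ^ p := by
  have h0 : 0 ≤ 1 - rexp (-t) := by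
    have : rexp (-t) ≤ 1 := exp_le_one_iff.2 (by linarith)
    linarith
  have h1 : 1 - rexp (-t) ≤ 1 := by linarith [exp_pos (-t)]
  rcases le_or_gt 1 t with h | h
  · exact (pow_le_one₀ h0 h1).trans (one_le_rpow h hp0)
  · have h2 : 1 - rexp (-t) ≤ t := by linarith [add_one_le_exp (-t)]
    refine (pow_le_pow_left₀ h0 h2 2).trans ?_
    rcases ht.eq_or_lt with rfl | ht
    · simpa using rpow_nonneg le_rfl p
    · rw [← rpow_two]
      exact rpow_le_rpow_of_exponent_ge ht h.le hp2

/-- If `V` has a finite moment of order `p < 2`, the second difference of its Laplace transform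
at the origin is `o(l ^ p)`. -/
lemma tendsto_second_difference_of_integrable_rpow (hV : ∀ ω, 0 ≤ V ω) (hm : AEMeasurable V μ)
    {p : ℝ} (hp0 : 0 ≤ p) (hp2 : p < 2) (hp : Integrable (fun ω => V ω ^ p) μ) :
    Tendsto (fun l => (∫ ω, (1 - rexp (-l * V ω)) ^ 2 ∂μ) / l ^ p) (𝓝[>] 0) (𝓝 0) := by
  have key : Tendsto (fun l => ∫ ω, (1 - rexp (-l * V ω)) ^ 2 / l ^ p ∂μ) (𝓝[>] 0)
      (𝓝 (∫ _, (0 : ℝ) ∂μ)) := by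
    refine tendsto_integral_filter_of_dominated_convergence (fun ω => V ω ^ p) ?_ ?_ hp ?_
    · filter_upwards [self_mem_nhdsWithin] with l hl
      exact ((integral_one_sub_exp_sq hV hm (le_of_lt hl)).1.div_const _).aestronglyMeasurable
    · filter_upwards [self_mem_nhdsWithin] with l hl
      have hl : 0 < l := hl
      refine Eventually.of_forall fun ω => ?_
      have h := one_sub_exp_neg_sq_le_rpow (mul_nonneg hl.le (hV ω)) hp0 hp2.le
      rw [norm_of_nonneg (by positivity), div_le_iff₀ (by positivity),
        mul_comm (V ω ^ p), ← mul_rpow hl.le (hV ω), neg_mul]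
      exact h
    · refine Eventually.of_forall fun ω => ?_
      have hlim : Tendsto (fun l : ℝ => V ω ^ 2 * l ^ (2 - p)) (𝓝[>] 0) (𝓝 0) := by
        have h := ((continuous_id.rpow_const fun _ => Or.inr (by linarith) :
          Continuous fun l : ℝ => l ^ (2 - p)).const_mul (V ω ^ 2)).tendsto 0
        rw [id, zero_rpow (by linarith), mul_zero] at h
        exact h.mono_left nhdsWithin_le_nhds
      refine squeeze_zero' ?_ ?_ hlim
      · filter_upwards [self_mem_nhdsWithin] with l hl
        have hl : 0 < l := hl
        positivity
      · filter_upwards [self_mem_nhdsWithin] with l hl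
        have hl : 0 < l := hl
        have h := one_sub_exp_neg_sq_le_rpow (mul_nonneg hl.le (hV ω)) zero_le_two le_rfl
        rw [div_le_iff₀ (by positivity), mul_assoc, ← rpow_add hl, neg_mul]
        refine h.trans_eq ?_
        rw [mul_rpow hl.le (hV ω), sub_add_cancel, rpow_two, rpow_two, mul_comm]
  simpa [integral_div] using key

lemma meas_ge_le_second_difference (hV : ∀ ω, 0 ≤ V ω) (hm : AEMeasurable V μ) {t : ℝ}
    (ht : 0 < t) : μ {ω | t ≤ V ω} ≤
      ENNReal.ofReal (((1 - rexp (-1)) ^ 2)⁻¹ * ∫ ω, (1 - rexp (-t⁻¹ * V ω)) ^ 2 ∂μ) := by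
  have hc1 : rexp (-1) < 1 := exp_lt_one_iff.2 (by norm_num)
  have hc : 0 < (1 - rexp (-1)) ^ 2 := by
    have : 0 < 1 - rexp (-1) := by linarith
    positivity
  have hi := (integral_one_sub_exp_sq hV hm (inv_nonneg.2 ht.le)).1
  have h := mul_meas_ge_le_integral_of_nonneg (Eventually.of_forall fun ω => sq_nonneg _) hi
    ((1 - rexp (-1)) ^ 2)
  have hsub : μ.real {ω | t ≤ V ω} ≤
      μ.real {ω | (1 - rexp (-1)) ^ 2 ≤ (1 - rexp (-t⁻¹ * V ω)) ^ 2} := by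
    refine measureReal_mono fun ω hω => ?_
    have hω : t ≤ V ω := hω
    have h1 : 1 ≤ t⁻¹ * V ω := by
      rw [inv_mul_eq_div]; exact (one_le_div ht).2 hω
    have h2 : rexp (-t⁻¹ * V ω) ≤ rexp (-1) := exp_le_exp.2 (by linarith)
    exact pow_le_pow_left₀ (sub_nonneg.2 hc1.le) (sub_le_sub_left h2 1) 2
  rw [← ofReal_measureReal]
  refine ENNReal.ofReal_le_ofReal ?_
  rw [inv_mul_eq_div, le_div_iff₀' hc]
  exact (mul_le_mul_of_nonneg_left hsub hc.le).trans h

lemma meas_inv_ge_le_laplace (hV : ∀ ω, 0 ≤ V ω) (hm : AEMeasurable V μ) {t : ℝ}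
    (ht : 0 < t) : μ {ω | t ≤ (V ω)⁻¹} ≤
      ENNReal.ofReal (rexp 1 * ∫ ω, rexp (-t * V ω) ∂μ) := by
  have h := mul_meas_ge_le_integral_of_nonneg
    (Eventually.of_forall fun ω => (exp_pos (-t * V ω)).le)
    (integrable_exp_neg_mul hV hm ht.le) (rexp (-1))
  have hsub : μ.real {ω | t ≤ (V ω)⁻¹} ≤ μ.real {ω | rexp (-1) ≤ rexp (-t * V ω)} := by
    refine measureReal_mono fun ω hω => ?_
    have hω : t ≤ (V ω)⁻¹ := hω
    have hVp : 0 < V ω := inv_pos.1 (ht.trans_le hω)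
    have h1 : t * V ω ≤ 1 := by
      have := mul_le_mul_of_nonneg_right hω hVp.le
      rwa [inv_mul_cancel₀ hVp.ne'] at this
    exact exp_le_exp.2 (by linarith)
  rw [← ofReal_measureReal]
  refine ENNReal.ofReal_le_ofReal ?_
  have h1 := mul_le_mul_of_nonneg_left ((mul_le_mul_of_nonneg_left hsub (exp_pos (-1)).le).trans h)
    (exp_pos 1).le
  rwa [← mul_assoc, ← exp_add, add_neg_cancel, exp_zero, one_mul] at h1

lemma lintegral_rpow_lt_top_mono (hV : ∀ ω, 0 ≤ V ω) {p q : ℝ} (hp : 0 ≤ p) (hpq : p ≤ q)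
    (h : ∫⁻ ω, ENNReal.ofReal (V ω ^ q) ∂μ < ⊤) : ∫⁻ ω, ENNReal.ofReal (V ω ^ p) ∂μ < ⊤ := by
  have hb : ∀ ω, ENNReal.ofReal (V ω ^ p) ≤ 1 + ENNReal.ofReal (V ω ^ q) := fun ω => by
    rcases le_total (V ω) 1 with h1 | h1
    · refine le_add_right ?_
      simpa using rpow_le_one (hV ω) h1 hp
    · exact le_add_left (ENNReal.ofReal_le_ofReal (rpow_le_rpow_of_exponent_le h1 hpq))
  refine (lintegral_mono hb).trans_lt ?_
  rw [lintegral_add_left measurable_const]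
  simpa using h

end LaplaceTransform

theorem stmt_8 {Ω : Type*} [MeasurableSpace Ω] (μ : Measure Ω) [IsProbabilityMeasure μ]
    (V : Ω → ℝ) (hV : ∀ ω, 0 ≤ V ω)
    (hL : ∀ l : ℝ, 0 ≤ l → ∫ ω, Real.exp (-l * V ω) ∂μ =
      3 ^ ((3 : ℝ) / 2) * Real.cosh ((2 * l) ^ ((1 : ℝ) / 4)) *
        (Real.cosh ((2 * l) ^ ((1 : ℝ) / 4)) ^ 2 + 2) ^ (-(3 : ℝ) / 2)) :
    ∀ β : ℝ, (∫⁻ ω, ENNReal.ofReal (V ω ^ β) ∂μ) < ⊤ ↔ β < 3 / 2 := by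
  replace hL : ∀ l : ℝ, 0 ≤ l → ∫ ω, Real.exp (-l * V ω) ∂μ =
    hullProfile ((2 * l) ^ ((1 : ℝ) / 4)) := hL
  have hm : AEMeasurable V μ :=
    aemeasurable_of_integral_exp_ne_zero (by rw [hL 1 zero_le_one]; exact (hullProfile_pos _).ne')
  obtain ⟨K, hK, hlim⟩ := exists_tendsto_hullProfile_second_difference
  have hlim' : Tendsto (fun l => (∫ ω, (1 - rexp (-l * V ω)) ^ 2 ∂μ) / l ^ ((3 : ℝ) / 2))
      (𝓝[>] 0) (𝓝 K) := by
    refine hlim.congr' ?_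
    filter_upwards [self_mem_nhdsWithin] with l hl
    have hl : 0 < l := hl
    rw [(integral_one_sub_exp_sq hV hm hl.le).2, hL l hl.le, hL (2 * l) (by positivity)]
  have hpos : ∀ p : ℝ, 0 < p → p < 3 / 2 → ∫⁻ ω, ENNReal.ofReal (V ω ^ p) ∂μ < ⊤ := by
    intro p hp hp'
    refine lintegral_rpow_lt_top_of_tail μ hV hm
      (C := ((1 - rexp (-1)) ^ 2)⁻¹ * (K + 1)) hp hp' ?_
    filter_upwards [tendsto_inv_atTop_nhdsGT_zero.eventually
      (hlim'.eventually (gt_mem_nhds (lt_add_one K))), eventually_gt_atTop 0] with t ht ht0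
    refine (meas_ge_le_second_difference hV hm ht0).trans (ENNReal.ofReal_le_ofReal ?_)
    rw [mul_assoc]
    refine mul_le_mul_of_nonneg_left ?_ (by positivity)
    rw [rpow_neg ht0.le, ← inv_rpow ht0.le]
    rw [div_lt_iff₀ (by positivity)] at ht
    exact ht.le
  intro β
  constructor
  · intro hβ
    by_contra! hge
    have hfin := lintegral_rpow_lt_top_mono hV (by norm_num : (0 : ℝ) ≤ 3 / 2) hge hβ
    have hint : Integrable (fun ω => V ω ^ ((3 : ℝ) / 2)) μ :=
      (lintegral_ofReal_ne_top_iff_integrable (hm.pow_const _).aestronglyMeasurable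
        (Eventually.of_forall fun ω => rpow_nonneg (hV ω) _)).1 hfin.ne
    have h0 := tendsto_second_difference_of_integrable_rpow hV hm (by norm_num) (by norm_num) hint
    exact hK.ne' (tendsto_nhds_unique hlim' h0)
  · intro hβ
    rcases lt_trichotomy β 0 with hneg | rfl | h0
    · obtain ⟨n, hn⟩ := exists_nat_gt (-β)
      obtain ⟨C, hC⟩ := hullProfile_rpow_le n
      have h := lintegral_rpow_lt_top_of_tail μ (X := fun ω => (V ω)⁻¹)
        (fun ω => inv_nonneg.2 (hV ω)) hm.inv (C := rexp 1 * C) (neg_pos.2 hneg) hn (by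
          filter_upwards [eventually_gt_atTop 0] with t ht
          refine (meas_inv_ge_le_laplace hV hm ht).trans (ENNReal.ofReal_le_ofReal ?_)
          rw [hL t ht.le, mul_assoc]
          exact mul_le_mul_of_nonneg_left (hC t ht) (exp_pos 1).le)
      refine lt_of_eq_of_lt (lintegral_congr fun ω => ?_) h
      rw [inv_rpow (hV ω), rpow_neg (hV ω), inv_inv]
    · simp
    · exact hpos β h0 hβ
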